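/- Asymptotics of the covariance (Lemma on mean and covariance, part 2): assume each Q_k(α) is finite, and fix ρ ∈ ℝ^m. Suppose there exist constants c, C > 0 such that for all k ≥ 1, Π_k(ρ) ≥ c k^m, |(∂/∂ρ_j) Π_k(ρ)| ≤ C k^m and |(∂²/∂ρ_i∂ρ_j) Π_k(ρ)| ≤ C k^m for all i,j = 1,…,m. Then there is a constant C′ > 0 such that the covariance matrix Σ_k(ρ)_{ij} := ∫_P (x_i − m_{k,i}(ρ))(x_j − m_{k,j}(ρ)) dμ_k^ρ(x) satisfies |Σ_k(ρ)_{ij} − k^{-1}(∂²φ/∂ρ_i∂ρ_j)(ρ)| ≤ C′/k² for all i,j and all k ≥ 1; that is, Σ_k(ρ) = k^{-1} Hess φ(ρ) + O(1/k²). -/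

import Mathlib

open MeasureTheory Real Filter
open scoped BigOperators Topology Classical ENNReal

noncomputable section

/-- Euclidean dot product on `ℝ^m`. -/
def dotp {m : ℕ} (x y : Fin m → ℝ) : ℝ := ∑ i, x i * y i

/-- Euclidean norm on `ℝ^m`. -/
def enorm' {m : ℕ} (x : Fin m → ℝ) : ℝ := Real.sqrt (∑ i, x i ^ 2)

/-- Partial derivative `∂f/∂ρ_j`. -/
def pd {m : ℕ} (f : (Fin m → ℝ) → ℝ) (j : Fin m) (ρ : Fin m → ℝ) : ℝ :=
  fderiv ℝ f ρ (Pi.single j 1)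

/-- Hessian matrix `(∂²f/∂ρ_i∂ρ_j)`. -/
def hess {m : ℕ} (f : (Fin m → ℝ) → ℝ) (ρ : Fin m → ℝ) : Matrix (Fin m) (Fin m) ℝ :=
  Matrix.of fun i j => pd (fun ρ' => pd f j ρ') i ρ

/-- Gradient map `∇f : ℝ^m → ℝ^m`. -/
def gradMap {m : ℕ} (f : (Fin m → ℝ) → ℝ) (ρ : Fin m → ℝ) : Fin m → ℝ :=
  fun i => pd f i ρ

/-- The rescaled lattice point `α/k ∈ ℝ^m`. -/
def lpt {m : ℕ} (k : ℕ) (α : Fin m → ℤ) : Fin m → ℝ := fun i => (α i : ℝ) / k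

/-- The norming constant `Q_k(α) = ∫ e^{⟨α,ρ⟩ - kφ(ρ)} det(Hess φ(ρ)) dρ`. -/
def Qk {m : ℕ} (φ : (Fin m → ℝ) → ℝ) (k : ℕ) (α : Fin m → ℤ) : ℝ :=
  ∫ ρ : Fin m → ℝ, Real.exp (dotp (fun i => (α i : ℝ)) ρ - k * φ ρ) * (hess φ ρ).det

/-- The Bergman weight `w_{k,α}(ρ) = e^{⟨α,ρ⟩ - kφ(ρ)}/Q_k(α)` for `α ∈ kP ∩ ℤ^m`. -/
def wt {m : ℕ} (P : Set (Fin m → ℝ)) (φ : (Fin m → ℝ) → ℝ) (k : ℕ) (α : Fin m → ℤ)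
    (ρ : Fin m → ℝ) : ℝ :=
  if lpt k α ∈ P then Real.exp (dotp (fun i => (α i : ℝ)) ρ - k * φ ρ) / Qk φ k α else 0

/-- The Bergman density of states `Π_k(ρ) = Σ_{α ∈ kP∩ℤ^m} w_{k,α}(ρ)`. -/
def dos {m : ℕ} (P : Set (Fin m → ℝ)) (φ : (Fin m → ℝ) → ℝ) (k : ℕ) (ρ : Fin m → ℝ) : ℝ :=
  ∑' α : Fin m → ℤ, wt P φ k α ρ

/-- The `j`-th component of the mean `m_k(ρ) = ∫_P x dμ_k^ρ(x)`. -/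
def meanB {m : ℕ} (P : Set (Fin m → ℝ)) (φ : (Fin m → ℝ) → ℝ) (k : ℕ) (ρ : Fin m → ℝ)
    (j : Fin m) : ℝ :=
  (dos P φ k ρ)⁻¹ * ∑' α : Fin m → ℤ, wt P φ k α ρ * lpt k α j

/-- The covariance entry `Σ_k(ρ)_{ij} = ∫_P (x_i - m_{k,i})(x_j - m_{k,j}) dμ_k^ρ(x)`. -/
def covB {m : ℕ} (P : Set (Fin m → ℝ)) (φ : (Fin m → ℝ) → ℝ) (k : ℕ) (ρ : Fin m → ℝ)
    (i j : Fin m) : ℝ :=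
  (dos P φ k ρ)⁻¹ * ∑' α : Fin m → ℤ,
    wt P φ k α ρ * (lpt k α i - meanB P φ k ρ i) * (lpt k α j - meanB P φ k ρ j)

theorem pd_eq_of_hasFDerivAt {m : ℕ} {f : (Fin m → ℝ) → ℝ} {f' : (Fin m → ℝ) →L[ℝ] ℝ}
    {ρ : Fin m → ℝ} (h : HasFDerivAt f f' ρ) (j : Fin m) : pd f j ρ = f' (Pi.single j 1) := by
  rw [pd, h.fderiv]

theorem hasFDerivAt_dotp {m : ℕ} (a ρ : Fin m → ℝ) :
    HasFDerivAt (dotp a) (∑ i, a i • ContinuousLinearMap.proj (R := ℝ) (φ := fun _ => ℝ) i) ρ := by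
  unfold dotp
  refine HasFDerivAt.fun_sum fun i _ => ?_
  exact (ContinuousLinearMap.proj (R := ℝ) (φ := fun _ => ℝ) i).hasFDerivAt.const_mul (a i)

theorem pd_dotp {m : ℕ} (a ρ : Fin m → ℝ) (j : Fin m) : pd (dotp a) j ρ = a j := by
  rw [pd_eq_of_hasFDerivAt (hasFDerivAt_dotp a ρ)]
  simp [Pi.single_apply]

theorem pd_sum {m : ℕ} {ι : Type*} (S : Finset ι) {f : ι → (Fin m → ℝ) → ℝ} {ρ : Fin m → ℝ}
    (hf : ∀ i ∈ S, DifferentiableAt ℝ (f i) ρ) (j : Fin m) :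
    pd (fun x => ∑ i ∈ S, f i x) j ρ = ∑ i ∈ S, pd (f i) j ρ := by
  simp only [pd]
  rw [fderiv_fun_sum hf, sum_apply]

theorem pd_mul {m : ℕ} {f g : (Fin m → ℝ) → ℝ} {ρ : Fin m → ℝ}
    (hf : DifferentiableAt ℝ f ρ) (hg : DifferentiableAt ℝ g ρ) (j : Fin m) :
    pd (fun x => f x * g x) j ρ = f ρ * pd g j ρ + pd f j ρ * g ρ := by
  rw [pd_eq_of_hasFDerivAt (hf.hasFDerivAt.fun_mul hg.hasFDerivAt)]
  simp [pd, mul_comm]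

theorem contDiff_pd {m : ℕ} {φ : (Fin m → ℝ) → ℝ} (hφ : ContDiff ℝ (⊤ : ℕ∞) φ) (j : Fin m) :
    ContDiff ℝ (⊤ : ℕ∞) (pd φ j) := by
  unfold pd
  exact (hφ.fderiv_right (m := ((⊤ : ℕ∞) : WithTop ℕ∞)) (by simp)).clm_apply contDiff_const

/-- Only finitely many lattice points lie in the dilate `kP` of a bounded set. -/
theorem finite_setOf_lpt_mem {m : ℕ} {P : Set (Fin m → ℝ)} (hP : Bornology.IsBounded P) {k : ℕ}
    (hk : 1 ≤ k) : {α : Fin m → ℤ | lpt k α ∈ P}.Finite := by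
  obtain ⟨R, hR⟩ := hP.exists_norm_le
  have hk' : (0 : ℝ) < k := by exact_mod_cast hk
  refine (Set.finite_Icc (fun _ : Fin m => -⌈k * R⌉) (fun _ => ⌈k * R⌉)).subset fun α hα => ?_
  have key : ∀ i, |(α i : ℝ)| ≤ ⌈k * R⌉ := fun i => by
    have h := (norm_le_pi_norm (lpt k α) i).trans (hR _ hα)
    rw [lpt, Real.norm_eq_abs, abs_div, Nat.abs_cast, div_le_iff₀ hk', mul_comm] at h
    exact h.trans (Int.le_ceil _)
  have key' : ∀ i, |α i| ≤ ⌈k * R⌉ := fun i => by exact_mod_cast key i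
  exact ⟨fun i => (abs_le.mp (key' i)).1, fun i => (abs_le.mp (key' i)).2⟩

theorem differentiable_wt {m : ℕ} (P : Set (Fin m → ℝ)) {φ : (Fin m → ℝ) → ℝ}
    (hφ : Differentiable ℝ φ) (k : ℕ) (α : Fin m → ℤ) : Differentiable ℝ (wt P φ k α) := by
  unfold wt
  split_ifs
  · have h : Differentiable ℝ (dotp fun i => (α i : ℝ)) :=
      fun x => (hasFDerivAt_dotp _ x).differentiableAt
    fun_prop
  · fun_prop

theorem pd_wt {m : ℕ} (P : Set (Fin m → ℝ)) {φ : (Fin m → ℝ) → ℝ}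
    (hφ : Differentiable ℝ φ) (k : ℕ) (α : Fin m → ℤ) (ρ : Fin m → ℝ) (j : Fin m) :
    pd (wt P φ k α) j ρ = wt P φ k α ρ * (α j - k * pd φ j ρ) := by
  unfold wt
  split_ifs
  · have h := (((hasFDerivAt_dotp (fun i => (α i : ℝ)) ρ).sub
      ((hφ ρ).hasFDerivAt.const_mul (k : ℝ))).exp).mul_const (Qk φ k α)⁻¹
    have h' := pd_dotp (fun i => (α i : ℝ)) ρ j
    rw [pd_eq_of_hasFDerivAt (hasFDerivAt_dotp _ ρ)] at h'
    simp only [div_eq_mul_inv]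
    refine (pd_eq_of_hasFDerivAt h j).trans ?_
    simp only [smul_apply, sub_apply, h', smul_eq_mul, pd, Pi.sub_apply]
    ring
  · simp [pd]

/-- The covariance is determined by the logarithmic Hessian of the density of states. -/
theorem covB_sub_hess_eq {m : ℕ} {P : Set (Fin m → ℝ)} (hP : Bornology.IsBounded P)
    {φ : (Fin m → ℝ) → ℝ} (hφ : ContDiff ℝ (⊤ : ℕ∞) φ) {k : ℕ} (hk : 1 ≤ k) {ρ : Fin m → ℝ}
    (hD : dos P φ k ρ ≠ 0) (i j : Fin m) :
    covB P φ k ρ i j - (k : ℝ)⁻¹ * hess φ ρ i j =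
      (pd (fun ρ' => pd (dos P φ k) j ρ') i ρ / dos P φ k ρ
        - pd (dos P φ k) i ρ / dos P φ k ρ * (pd (dos P φ k) j ρ / dos P φ k ρ)) / (k : ℝ) ^ 2 := by
  have hk' : (k : ℝ) ≠ 0 := by positivity
  have hφd : Differentiable ℝ φ := hφ.differentiable (by simp)
  set S := (finite_setOf_lpt_mem hP hk).toFinset with hS
  have hzero : ∀ α ∉ S, ∀ x, wt P φ k α x = 0 := fun α hα x => by
    rw [hS, Set.Finite.mem_toFinset] at hα
    exact if_neg hα
  have hdos : dos P φ k = fun x => ∑ α ∈ S, wt P φ k α x := by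
    funext x
    exact tsum_eq_sum fun α hα => hzero α hα x
  have hpd : ∀ j x, pd (dos P φ k) j x = ∑ α ∈ S, wt P φ k α x * (α j - k * pd φ j x) := by
    intro j x
    rw [hdos, pd_sum S fun α _ => differentiable_wt P hφd k α x]
    exact Finset.sum_congr rfl fun α _ => pd_wt P hφd k α x j
  have hpd2 : pd (fun ρ' => pd (dos P φ k) j ρ') i ρ =
      ∑ α ∈ S, (wt P φ k α ρ * ((α i - k * pd φ i ρ) * (α j - k * pd φ j ρ))
        - wt P φ k α ρ * (k * hess φ ρ i j)) := by
    have hpdφ : DifferentiableAt ℝ (pd φ j) ρ := (contDiff_pd hφ j).differentiable (by simp) ρ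
    have hfac : ∀ α : Fin m → ℤ, HasFDerivAt (fun x => (α j : ℝ) - k * pd φ j x)
        (-((k : ℝ) • fderiv ℝ (pd φ j) ρ)) ρ :=
      fun α => (hpdφ.hasFDerivAt.const_mul (k : ℝ)).const_sub _
    simp only [hpd]
    rw [pd_sum S fun α _ => (differentiable_wt P hφd k α ρ).fun_mul (hfac α).differentiableAt]
    refine Finset.sum_congr rfl fun α _ => ?_
    rw [pd_mul (differentiable_wt P hφd k α ρ) (hfac α).differentiableAt, pd_wt P hφd,
      pd_eq_of_hasFDerivAt (hfac α)]
    change _ = wt P φ k α ρ * _ - wt P φ k α ρ * (k * fderiv ℝ (pd φ j) ρ (Pi.single i 1))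
    simp only [neg_apply, smul_apply, smul_eq_mul]
    ring
  have hmean : ∀ j, meanB P φ k ρ j
      = (dos P φ k ρ)⁻¹ * ∑ α ∈ S, wt P φ k α ρ * lpt k α j := fun j => by
    rw [meanB, tsum_eq_sum fun α hα => by rw [hzero α hα, zero_mul]]
  have hcov : covB P φ k ρ i j = (dos P φ k ρ)⁻¹ * ∑ α ∈ S,
      wt P φ k α ρ * (lpt k α i - meanB P φ k ρ i) * (lpt k α j - meanB P φ k ρ j) := by
    rw [covB, tsum_eq_sum fun α hα => by rw [hzero α hα, zero_mul, zero_mul]]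
  have hα : ∀ (α : Fin m → ℤ) j, (α j : ℝ) = k * lpt k α j := fun α j => by
    rw [lpt]; field_simp
  have hD' : ∑ α ∈ S, wt P φ k α ρ = dos P φ k ρ := (congrFun hdos ρ).symm
  set D := dos P φ k ρ
  have hM : ∀ j, ∑ α ∈ S, wt P φ k α ρ * lpt k α j = D * meanB P φ k ρ j := fun j => by
    rw [hmean]; field_simp
  have hcov' : covB P φ k ρ i j = D⁻¹ * ∑ α ∈ S, wt P φ k α ρ * (lpt k α i * lpt k α j)
      - meanB P φ k ρ i * meanB P φ k ρ j := by
    have : ∀ α, wt P φ k α ρ * (lpt k α i - meanB P φ k ρ i) * (lpt k α j - meanB P φ k ρ j)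
        = wt P φ k α ρ * (lpt k α i * lpt k α j)
          - wt P φ k α ρ * lpt k α i * meanB P φ k ρ j
          - wt P φ k α ρ * lpt k α j * meanB P φ k ρ i
          + wt P φ k α ρ * (meanB P φ k ρ i * meanB P φ k ρ j) := fun α => by ring
    rw [hcov]
    simp only [this, Finset.sum_add_distrib, Finset.sum_sub_distrib, ← Finset.sum_mul, hM, hD']
    field_simp
    ring
  have hpd1' : ∀ j, pd (dos P φ k) j ρ = k * D * (meanB P φ k ρ j - pd φ j ρ) := fun j => by
    have : ∀ α : Fin m → ℤ, wt P φ k α ρ * (α j - k * pd φ j ρ)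
        = wt P φ k α ρ * lpt k α j * k - wt P φ k α ρ * (k * pd φ j ρ) := fun α => by
      rw [hα α j]; ring
    rw [hpd]
    simp only [this, Finset.sum_sub_distrib, ← Finset.sum_mul, hM, hD']
    ring
  have hpd2' : pd (fun ρ' => pd (dos P φ k) j ρ') i ρ =
      k ^ 2 * ((∑ α ∈ S, wt P φ k α ρ * (lpt k α i * lpt k α j))
        - D * meanB P φ k ρ i * pd φ j ρ - D * meanB P φ k ρ j * pd φ i ρ
        + D * (pd φ i ρ * pd φ j ρ)) - D * (k * hess φ ρ i j) := by
    have : ∀ α : Fin m → ℤ,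
        wt P φ k α ρ * ((α i - k * pd φ i ρ) * (α j - k * pd φ j ρ))
        = wt P φ k α ρ * (lpt k α i * lpt k α j) * k ^ 2
          - wt P φ k α ρ * lpt k α i * (k ^ 2 * pd φ j ρ)
          - wt P φ k α ρ * lpt k α j * (k ^ 2 * pd φ i ρ)
          + wt P φ k α ρ * (k ^ 2 * (pd φ i ρ * pd φ j ρ)) := fun α => by
      rw [hα α i, hα α j]; ring
    rw [hpd2]
    simp only [this, Finset.sum_add_distrib, Finset.sum_sub_distrib, ← Finset.sum_mul, hM, hD']
    ring
  rw [hcov', hpd2', hpd1', hpd1']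
  field_simp
  ring

/-- asymptotics of the covariance: `Σ_k(ρ) = k⁻¹ Hess φ(ρ) + O(1/k²)`. -/
theorem covariance_asymptotics {m : ℕ}
    (P : Set (Fin m → ℝ)) (hPcpt : IsCompact P) (hPconv : Convex ℝ P)
    (hPint : (interior P).Nonempty)
    (φ : (Fin m → ℝ) → ℝ) (hφ : ContDiff ℝ (⊤ : ℕ∞) φ)
    (hφpos : ∀ ρ : Fin m → ℝ, (hess φ ρ).PosDef)
    (hφbij : Set.BijOn (gradMap φ) Set.univ (interior P))
    (hQfin : ∀ k : ℕ, 1 ≤ k → ∀ α : Fin m → ℤ, lpt k α ∈ P →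
      Integrable (fun ρ : Fin m → ℝ =>
        Real.exp (dotp (fun i => (α i : ℝ)) ρ - k * φ ρ) * (hess φ ρ).det))
    (ρ : Fin m → ℝ) (c C : ℝ) (hc : 0 < c) (hC : 0 < C)
    (hlow : ∀ k : ℕ, 1 ≤ k → c * (k : ℝ) ^ m ≤ dos P φ k ρ)
    (hder : ∀ k : ℕ, 1 ≤ k → ∀ j : Fin m, |pd (dos P φ k) j ρ| ≤ C * (k : ℝ) ^ m)
    (hder2 : ∀ k : ℕ, 1 ≤ k → ∀ i j : Fin m,
      |pd (fun ρ' => pd (dos P φ k) j ρ') i ρ| ≤ C * (k : ℝ) ^ m) :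
    ∃ C' > 0, ∀ k : ℕ, 1 ≤ k → ∀ i j : Fin m,
      |covB P φ k ρ i j - (k : ℝ)⁻¹ * hess φ ρ i j| ≤ C' / (k : ℝ) ^ 2 := by
  refine ⟨C / c + C / c * (C / c), by positivity, fun k hk i j => ?_⟩
  have hkm : (0 : ℝ) < (k : ℝ) ^ m := by positivity
  have hDpos : 0 < dos P φ k ρ := (mul_pos hc hkm).trans_le (hlow k hk)
  have hquot : ∀ a : ℝ, |a| ≤ C * (k : ℝ) ^ m → |a / dos P φ k ρ| ≤ C / c := fun a ha => by
    rw [abs_div, abs_of_pos hDpos, ← mul_div_mul_right C c hkm.ne']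
    exact div_le_div₀ (by positivity) ha (by positivity) (hlow k hk)
  rw [covB_sub_hess_eq hPcpt.isBounded hφ hk hDpos.ne', abs_div,
    abs_of_pos (show (0 : ℝ) < (k : ℝ) ^ 2 by positivity)]
  gcongr
  refine (abs_sub _ _).trans (add_le_add (hquot _ (hder2 k hk i j)) ?_)
  rw [abs_mul]
  exact mul_le_mul (hquot _ (hder k hk i)) (hquot _ (hder k hk j)) (abs_nonneg _) (by positivity)
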